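/- Let p be a prime, k a field of characteristic p, and k[𝔛] the graded polynomial ring in variables x_1,…,x_m with deg x_i = p^{d_i}. Let I and I' be twisted-linear ideals of k[𝔛], each generated by twisted-linear elements of degree ≤ p^M. Then dim_k (k[𝔛]/I)_d = dim_k (k[𝔛]/I')_d for all d ∈ ℕ if and only if dim_k (FPV_i(k) ∩ I) = dim_k (FPV_i(k) ∩ I') for all i = 0, 1, …, M. (In other words, the Hilbert function of a twisted-linear ideal generated in degrees ≤ p^M determines the dimensions of its twisted-linear parts FPV_i ∩ I for i ≤ M, and vice versa.) -/

import Mathlib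

open MvPolynomial

/-- `FPV p k mv d l` is the `k`-subspace of the polynomial ring `k[x_1,…,x_mv]`
(graded by `deg x_i = p^{d i}`) spanned by the twisted-linear monomials
`x_i ^ p^(l - d i)` for those `i` with `d i ≤ l`. -/
noncomputable def FPV (p : ℕ) (k : Type*) [Field k] (mv : ℕ) (d : Fin mv → ℕ) (l : ℕ) :
    Submodule k (MvPolynomial (Fin mv) k) :=
  Submodule.span k {f | ∃ i : Fin mv, d i ≤ l ∧ f = X i ^ p ^ (l - d i)}

/-- The Hilbert function of a graded ideal `I ⊆ k[x_1,…,x_mv]` (grading by `deg x_i = p^{d i}`):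
`d ↦ dim_k (k[𝔛]/I)_dd`, computed as the dimension of the degree-`dd` homogeneous component
modulo its intersection with `I`. -/
noncomputable def hilbertFn (p : ℕ) (k : Type*) [Field k] (mv : ℕ) (d : Fin mv → ℕ)
    (I : Ideal (MvPolynomial (Fin mv) k)) (dd : ℕ) : ℕ :=
  Module.finrank k
    (↥(weightedHomogeneousSubmodule k (fun i => p ^ d i) dd) ⧸
      Submodule.comap (weightedHomogeneousSubmodule k (fun i => p ^ d i) dd).subtype
        (I.restrictScalars k))

noncomputable def PS (p : ℕ) (s : Multiset ℕ) : PowerSeries ℤ :=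
  (s.map (fun l => (1 - (PowerSeries.X : PowerSeries ℤ) ^ p ^ l))).prod

lemma PS_add (p : ℕ) (s t : Multiset ℕ) : PS p (s + t) = PS p s * PS p t := by
  simp [PS]

lemma PS_low (p : ℕ) (hp : p.Prime) (l : ℕ) (s : Multiset ℕ) (hs : ∀ j ∈ s, l ≤ j) :
    (PowerSeries.X : PowerSeries ℤ) ^ (p ^ l + 1) ∣
      PS p s - (1 - (s.count l : PowerSeries ℤ) * PowerSeries.X ^ p ^ l) := by
  induction s using Multiset.induction_on with
  | empty => simp [PS]
  | cons a s ih =>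
    obtain ⟨c, hc⟩ := ih (fun j hj => hs j (Multiset.mem_cons_of_mem hj))
    have hc' : PS p s = (1 - (s.count l : PowerSeries ℤ) * PowerSeries.X ^ p ^ l) +
      PowerSeries.X ^ (p ^ l + 1) * c := by rw [← hc]; ring
    have h1 : PS p (a ::ₘ s) = (1 - PowerSeries.X ^ p ^ a) * PS p s := by simp [PS]
    rw [h1, hc']
    have hla := hs a (Multiset.mem_cons_self a s)
    rcases hla.eq_or_lt with h | h
    · subst h
      obtain ⟨n, hn⟩ : ∃ n, p ^ l = n + 1 := ⟨p ^ l - 1, by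
        have := Nat.pos_of_ne_zero (pow_ne_zero l hp.ne_zero); omega⟩
      rw [Multiset.count_cons_self, hn]
      refine ⟨(1 - PowerSeries.X ^ (n + 1)) * c + (s.count l : PowerSeries ℤ) * PowerSeries.X ^ n, ?_⟩
      push_cast
      ring
    · rw [Multiset.count_cons_of_ne h.ne]
      have : p ^ l + 1 ≤ p ^ a := Nat.pow_lt_pow_right hp.one_lt h
      obtain ⟨n, hn⟩ := Nat.exists_eq_add_of_le this
      rw [hn]
      refine ⟨(1 - PowerSeries.X ^ (p ^ l + 1 + n)) * c -  PowerSeries.X ^ n * (1 - (s.count l : PowerSeries ℤ) * PowerSeries.X ^ p ^ l), ?_⟩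
      ring

lemma PS_ne_zero (p : ℕ) (hp : p.Prime) (s : Multiset ℕ) : PS p s ≠ 0 := by
  unfold PS
  rw [Ne, Multiset.prod_eq_zero_iff]
  simp only [Multiset.mem_map, not_exists, not_and]
  intro l _ h
  have := congrArg (PowerSeries.constantCoeff) h
  simp [hp.ne_zero] at this

lemma PS_inj (p : ℕ) (hp : p.Prime) (s t : Multiset ℕ) (h : PS p s = PS p t) : s = t := by
  ext l
  induction l using Nat.strong_induction_on with
  | _ l ih =>
    have e : s.filter (· < l) = t.filter (· < l) := by
      ext j
      by_cases hj : j < l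
      · simp [Multiset.count_filter, hj, ih j hj]
      · simp [Multiset.count_filter, hj]
    rw [← Multiset.filter_add_not (· < l) s, ← Multiset.filter_add_not (· < l) t, PS_add, PS_add, e] at h
    have h' := mul_left_cancel₀ (PS_ne_zero p hp _) h
    have hs := PS_low p hp l (s.filter (fun a => ¬ a < l)) (by simp)
    have ht := PS_low p hp l (t.filter (fun a => ¬ a < l)) (by simp)
    rw [h'] at hs
    have hd := dvd_sub hs ht
    rw [PowerSeries.X_pow_dvd_iff] at hd
    have := hd (p ^ l) (by omega)
    have cc : ∀ (c : ℕ) , PowerSeries.coeff (p^l) ((c : PowerSeries ℤ) * PowerSeries.X ^ p ^ l) = (c : ℤ) := by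
      intro c
      have : (c : PowerSeries ℤ) = PowerSeries.C (c : ℤ) := by simp
      rw [this, PowerSeries.coeff_C_mul, PowerSeries.coeff_X_pow_self, mul_one]
    simp only [map_sub, cc, Multiset.count_filter, lt_irrefl, not_false_eq_true, if_true] at this
    omega

lemma multiset_eq_iff (M : ℕ) (s t : Multiset ℕ) (hs : ∀ j ∈ s, j ≤ M) (ht : ∀ j ∈ t, j ≤ M) :
    s = t ↔ ∀ i ≤ M, (s.filter (· ≤ i)).card = (t.filter (· ≤ i)).card := by
  constructor
  · rintro rfl; simp
  · intro h
    have key : ∀ (u : Multiset ℕ) l, (u.filter (· ≤ l + 1)).card = (u.filter (· ≤ l)).card + u.count (l + 1) := by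
      intro u l
      rw [← Multiset.countP_eq_card_filter, ← Multiset.countP_eq_card_filter, Multiset.count]
      induction u using Multiset.induction_on with
      | empty => simp
      | cons a u ih =>
        simp only [Multiset.countP_cons, ih]
        split_ifs <;> omega
    have key0 : ∀ (u : Multiset ℕ), (u.filter (· ≤ 0)).card = u.count 0 := by
      intro u
      rw [← Multiset.countP_eq_card_filter, Multiset.count]
      congr 1; ext; simp [eq_comm]
    ext l
    by_cases hl : l ≤ M
    · cases l with
      | zero => rw [← key0, ← key0]; exact h _ hl
      | succ l =>
        have h1 := h _ hl
        have h2 := h l (by omega)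
        rw [key, key] at h1
        omega
    · rw [Multiset.count_eq_zero_of_notMem (fun h => hl (hs _ h)), Multiset.count_eq_zero_of_notMem (fun h => hl (ht _ h))]

noncomputable def cnt {m : ℕ} (w : Fin m → ℕ) (q : Fin m → ℕ) (A : Finset (Fin m)) (n : ℕ) : ℕ :=
  Set.ncard {a : Fin m →₀ ℕ | Finsupp.weight w a = n ∧ ∀ i ∈ A, a i < q i}

lemma wt_finite {m : ℕ} (w : Fin m → ℕ) (hw : ∀ i, w i ≠ 0) (n : ℕ) :
    {a : Fin m →₀ ℕ | Finsupp.weight w a = n}.Finite :=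
  (Finsupp.finite_of_nat_weight_le w hw n).subset (fun a ha => le_of_eq ha)

noncomputable def HS {m : ℕ} (w : Fin m → ℕ) (q : Fin m → ℕ) (A : Finset (Fin m)) : PowerSeries ℤ :=
  PowerSeries.mk fun n => (cnt w q A n : ℤ)

lemma HS_insert {m : ℕ} (w : Fin m → ℕ) (hw : ∀ i, w i ≠ 0) (q : Fin m → ℕ) (A : Finset (Fin m))
    (i : Fin m) (hi : i ∉ A) :
    HS w q (insert i A) = HS w q A * (1 - PowerSeries.X ^ (q i * w i)) := by
  ext n
  rw [mul_sub, mul_one, map_sub, PowerSeries.coeff_mul_X_pow']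
  simp only [HS, PowerSeries.coeff_mk]
  have hsub : {a : Fin m →₀ ℕ | Finsupp.weight w a = n ∧ ∀ j ∈ insert i A, a j < q j} ⊆
    {a : Fin m →₀ ℕ | Finsupp.weight w a = n ∧ ∀ j ∈ A, a j < q j} := by
    intro a ha; exact ⟨ha.1, fun j hj => ha.2 j (Finset.mem_insert_of_mem hj)⟩
  have hfin : {a : Fin m →₀ ℕ | Finsupp.weight w a = n ∧ ∀ j ∈ A, a j < q j}.Finite :=
    (wt_finite w hw n).subset (fun a ha => ha.1)
  have h1 := Set.ncard_sdiff_add_ncard_of_subset hsub hfin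
  have h2 : ({a : Fin m →₀ ℕ | Finsupp.weight w a = n ∧ ∀ j ∈ A, a j < q j} \ {a : Fin m →₀ ℕ | Finsupp.weight w a = n ∧ ∀ j ∈ insert i A, a j < q j}).ncard
     = if q i * w i ≤ n then cnt w q A (n - q i * w i) else 0 := by
    have hwt : ∀ a : Fin m →₀ ℕ, Finsupp.weight w (a + Finsupp.single i (q i)) = Finsupp.weight w a + q i * w i := by
      intro a; rw [map_add, Finsupp.weight_single]; simp
    have hdec : ∀ a : Fin m →₀ ℕ, q i ≤ a i → ∃ b, a = b + Finsupp.single i (q i) := by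
      intro a ha
      refine ⟨a - Finsupp.single i (q i), (tsub_add_cancel_of_le ?_).symm⟩
      rw [Finsupp.single_le_iff]; exact ha
    split_ifs with hn
    · rw [cnt, ← Set.ncard_image_of_injective {a : Fin m →₀ ℕ | Finsupp.weight w a = n - q i * w i ∧ ∀ j ∈ A, a j < q j} (add_left_injective (Finsupp.single i (q i)))]
      congr 1
      ext a
      simp only [Set.mem_sdiff, Set.mem_ofPred_eq, Set.mem_image, Finset.mem_insert]
      constructor
      · rintro ⟨⟨h1, h2⟩, h3⟩
        have : q i ≤ a i := by
          by_contra hlt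
          push Not at hlt
          exact h3 ⟨h1, fun j hj => by rcases hj with rfl | hj; exact hlt; exact h2 j hj⟩
        obtain ⟨b, rfl⟩ := hdec a this
        rw [hwt] at h1
        refine ⟨b, ⟨by omega, fun j hj => ?_⟩, rfl⟩
        exact lt_of_le_of_lt (by simp) (h2 j hj)
      · rintro ⟨b, ⟨h1, h2⟩, rfl⟩
        refine ⟨⟨by rw [hwt]; omega, fun j hj => ?_⟩, fun h => ?_⟩
        · have : i ≠ j := fun h => hi (h ▸ hj)
          simpa [Finsupp.single_apply, this] using h2 j hj
        · have := h.2 i (Or.inl rfl)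
          simp at this
    · rw [Set.ncard_eq_zero (hfin.subset Set.sdiff_subset), Set.eq_empty_iff_forall_notMem]
      rintro a ⟨⟨h1, h2⟩, h3⟩
      apply h3
      refine ⟨h1, fun j hj => ?_⟩
      rcases Finset.mem_insert.1 hj with rfl | hj
      · by_contra hlt
        push Not at hlt
        obtain ⟨b, rfl⟩ := hdec a hlt
        rw [hwt] at h1
        omega
      · exact h2 j hj
  rw [h2] at h1
  have h3 : (cnt w q (insert i A) n : ℤ) + (if q i * w i ≤ n then cnt w q A (n - q i * w i) else 0 : ℕ) = cnt w q A n := by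
    unfold cnt at h1 ⊢
    rw [← h1]; push_cast; ring
  rw [← h3]
  split_ifs <;> simp

lemma HS_empty {m : ℕ} (w q q' : Fin m → ℕ) : HS w q ∅ = HS w q' ∅ := by
  simp [HS, cnt]

lemma HS_empty_ne {m : ℕ} (w : Fin m → ℕ) (hw : ∀ i, w i ≠ 0) (q : Fin m → ℕ) : HS w q ∅ ≠ 0 := by
  intro h
  have := congrArg (PowerSeries.coeff 0) h
  simp only [HS, PowerSeries.coeff_mk, cnt, map_zero, Nat.cast_eq_zero] at this
  rw [Set.ncard_eq_zero ((wt_finite w hw 0).subset (fun a ha => ha.1))] at this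
  have h0 : (0 : Fin m →₀ ℕ) ∈ {a : Fin m →₀ ℕ | Finsupp.weight w a = 0 ∧ ∀ i ∈ (∅ : Finset (Fin m)), a i < q i} := by simp
  rw [this] at h0
  exact h0

lemma HS_eq {m : ℕ} (p : ℕ) (hp : p.Prime) (d e : Fin m → ℕ) (hde : ∀ i, d i ≤ e i) (A : Finset (Fin m)) :
    HS (fun i => p ^ d i) (fun i => p ^ (e i - d i)) A =
     HS (fun i => p ^ d i) (fun i => p ^ (e i - d i)) ∅ * PS p (A.val.map e) := by
  induction A using Finset.induction_on with
  | empty => simp [PS]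
  | insert i A hi ih =>
    rw [HS_insert _ (fun i => pow_ne_zero _ hp.ne_zero) _ _ _ hi, ih, ← pow_add, Nat.sub_add_cancel (hde i)]
    simp [PS, Multiset.ndinsert_of_notMem, hi]
    ring

lemma comb_main {m : ℕ} (p : ℕ) (hp : p.Prime) (M : ℕ) (d e e' : Fin m → ℕ) (A A' : Finset (Fin m))
   (hde : ∀ i, d i ≤ e i) (hde' : ∀ i, d i ≤ e' i) (hM : ∀ i ∈ A, e i ≤ M) (hM' : ∀ i ∈ A', e' i ≤ M) :
   (∀ n, cnt (fun i => p ^ d i) (fun i => p ^ (e i - d i)) A n =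
     cnt (fun i => p ^ d i) (fun i => p ^ (e' i - d i)) A' n) ↔
   ∀ l ≤ M, (A.filter (fun i => e i ≤ l)).card = (A'.filter (fun i => e' i ≤ l)).card := by
  have h1 : (∀ n, cnt (fun i => p ^ d i) (fun i => p ^ (e i - d i)) A n =
     cnt (fun i => p ^ d i) (fun i => p ^ (e' i - d i)) A' n) ↔
     HS (fun i => p ^ d i) (fun i => p ^ (e i - d i)) A = HS (fun i => p ^ d i) (fun i => p ^ (e' i - d i)) A' := by
    simp [HS, PowerSeries.ext_iff]
  rw [h1, HS_eq p hp d e hde, HS_eq p hp d e' hde', HS_empty _ _ (fun i => p ^ (e' i - d i)),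
    mul_right_inj' (HS_empty_ne _ (fun i => pow_ne_zero _ hp.ne_zero) _)]
  have h2 : PS p (A.val.map e) = PS p (A'.val.map e') ↔ (A.val.map e) = (A'.val.map e') :=
    ⟨PS_inj p hp _ _, fun h => by rw [h]⟩
  rw [h2, multiset_eq_iff M _ _ (by simpa using hM) (by simpa using hM')]
  simp [Multiset.filter_map, Finset.card, Function.comp_def]

lemma li_inf {k V ι : Type*} [Field k] [AddCommGroup V] [Module k V] (g : ι → V)
    (hg : LinearIndependent k g) (D B : Set ι) :
    Submodule.span k (g '' D) ⊓ Submodule.span k (g '' B) = Submodule.span k (g '' (D ∩ B)) := by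
  simp only [Finsupp.span_image_eq_map_linearCombination]
  rw [← Submodule.map_inf _ hg, ← Finsupp.supported_inter]

lemma li_finrank {k V ι : Type*} [Field k] [AddCommGroup V] [Module k V] (g : ι → V)
    (hg : LinearIndependent k g) (D : Set ι) (hD : D.Finite) :
    Module.finrank k (Submodule.span k (g '' D)) = D.ncard := by
  have : Fintype D := hD.fintype
  have h := finrank_span_eq_card (R := k) (b := fun i : D => g i) (hg.comp _ Subtype.val_injective)
  have e : Set.range (fun i : D => g i) = g '' D := by ext; simp
  rw [e] at h
  rw [h, ← Nat.card_eq_fintype_card]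
  rfl

lemma quot_finrank {k V ι : Type*} [Field k] [AddCommGroup V] [Module k V] (g : ι → V)
    (hg : LinearIndependent k g) (D B : Set ι) (hD : D.Finite) (U W : Submodule k V)
    (hU : U = Submodule.span k (g '' D)) (hW : W = Submodule.span k (g '' B)) :
    Module.finrank k (U ⧸ Submodule.comap U.subtype W) = (D \ B).ncard := by
  have : Module.Finite k U := by
    rw [hU, Module.Finite.iff_fg]
    exact Submodule.fg_span (hD.image _)
  have h1 := Submodule.finrank_quotient_add_finrank (Submodule.comap U.subtype W)
  have h2 : Module.finrank k (Submodule.comap U.subtype W) = (D ∩ B).ncard := by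
    rw [← li_finrank g hg (D ∩ B) (hD.subset Set.inter_subset_left), ← li_inf g hg, ← hU, ← hW]
    rw [← Submodule.map_comap_subtype]
    exact (LinearEquiv.finrank_eq (Submodule.equivMapOfInjective _ U.injective_subtype _))
  have h3 : Module.finrank k U = D.ncard := by rw [hU]; exact li_finrank g hg D hD
  have h4 := Set.ncard_inter_add_ncard_sdiff_eq_ncard D B hD
  omega

section mo
variable {k : Type*} [Field k] {m : ℕ} (o : MonomialOrder (Fin m))
  (g : (Fin m →₀ ℕ) → MvPolynomial (Fin m) k)
  (hgm : ∀ a, o.Monic (g a)) (hgd : ∀ a, o.degree (g a) = a)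
include hgm hgd

lemma g_li : LinearIndependent k g := by
  rw [linearIndependent_iff]
  intro l hl
  by_contra hne
  have hs : l.support.Nonempty := Finsupp.support_nonempty_iff.2 hne
  obtain ⟨a, ha, hmax⟩ := Finset.exists_max_image l.support o.toSyn hs
  have h := congrArg (coeff a) hl
  rw [Finsupp.linearCombination_apply, Finsupp.sum, coeff_sum, Finset.sum_eq_single a] at h
  · rw [coeff_smul] at h
    have := (hgm a).coeff_degree
    rw [hgd] at this
    simp [this] at h
    simp [h] at ha
  · intro b hb hba
    rw [coeff_smul, o.coeff_eq_zero_of_lt, smul_zero]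
    rw [hgd]
    exact lt_of_le_of_ne (hmax b hb) (fun h => hba (o.toSyn.injective h))
  · intro h; exact absurd ha h

lemma g_span : Submodule.span k (Set.range g) = ⊤ := by
  rw [eq_top_iff]
  have key : ∀ (s : o.syn) (f : MvPolynomial (Fin m) k), o.toSyn (o.degree f) = s →
      f ∈ Submodule.span k (Set.range g) := by
    intro s
    induction s using WellFoundedLT.induction with
    | _ s ih =>
      intro f hf
      have hmem : o.leadingCoeff f • g (o.degree f) ∈ Submodule.span k (Set.range g) :=
        Submodule.smul_mem _ _ (Submodule.subset_span ⟨_, rfl⟩)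
      rw [← sub_add_cancel f (o.leadingCoeff f • g (o.degree f))]
      refine Submodule.add_mem _ ?_ hmem
      by_cases hz : f - o.leadingCoeff f • g (o.degree f) = 0
      · rw [hz]; exact Submodule.zero_mem _
      refine ih _ ?_ _ rfl
      rw [← hf]
      set r := f - o.leadingCoeff f • g (o.degree f) with hr
      have hle : o.toSyn (o.degree r) ≤ o.toSyn (o.degree f) := by
        refine o.degree_sub_le.trans (sup_le le_rfl ?_)
        refine o.degree_smul_le.trans ?_
        rw [hgd]
      refine lt_of_le_of_ne hle (fun heq => ?_)
      have heq' := o.toSyn.injective heq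
      have hc : coeff (o.degree r) r ≠ 0 := o.coeff_degree_ne_zero_iff.2 hz
      rw [heq'] at hc
      apply hc
      have := (hgm (o.degree f)).coeff_degree
      rw [hgd] at this
      rw [hr, coeff_sub, coeff_smul, this]
      simp [MonomialOrder.leadingCoeff]
  intro f _
  exact key _ f rfl
end mo

noncomputable def gfam {k : Type*} [Field k] {m : ℕ} (q : Fin m → ℕ) (f : Fin m → MvPolynomial (Fin m) k)
    (a : Fin m →₀ ℕ) : MvPolynomial (Fin m) k :=
  ∏ i, (X i ^ (a i % q i) * f i ^ (a i / q i))

section gf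
variable {k : Type*} [Field k] {m : ℕ} (o : MonomialOrder (Fin m))
  (q : Fin m → ℕ) (f : Fin m → MvPolynomial (Fin m) k)

lemma gfam_monic (hfm : ∀ i, o.Monic (f i)) (a : Fin m →₀ ℕ) : o.Monic (gfam q f a) :=
  MonomialOrder.Monic.prod fun i _ => (o.monic_X.pow).mul ((hfm i).pow)

lemma gfam_degree (hfm : ∀ i, o.Monic (f i)) (hfd : ∀ i, o.degree (f i) = Finsupp.single i (q i))
    (a : Fin m →₀ ℕ) : o.degree (gfam q f a) = a := by
  unfold gfam
  rw [o.degree_prod]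
  · have : ∀ i, o.degree (X i ^ (a i % q i) * f i ^ (a i / q i)) = Finsupp.single i (a i) := by
      intro i
      rw [o.degree_mul ((o.monic_X.pow).ne_zero) ((hfm i).pow.ne_zero), o.degree_pow, o.degree_pow, hfd,
        o.degree_X, Finsupp.smul_single, Finsupp.smul_single, ← Finsupp.single_add]
      congr 1
      simp only [smul_eq_mul, mul_one]
      rw [mul_comm (a i / q i)]
      exact Nat.mod_add_div _ _
    simp only [this]
    exact Finsupp.univ_sum_single a
  · intro i _
    exact ((o.monic_X.pow).mul ((hfm i).pow)).ne_zero

lemma gfam_mul (hq : ∀ i, 0 < q i) (a : Fin m →₀ ℕ) (i : Fin m) :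
    f i * gfam q f a = gfam q f (a + Finsupp.single i (q i)) := by
  unfold gfam
  rw [← Finset.mul_prod_erase _ _ (Finset.mem_univ i), ← Finset.mul_prod_erase _ _ (Finset.mem_univ i),
    ← mul_assoc]
  congr 1
  · simp only [Finsupp.add_apply, Finsupp.single_eq_same, Nat.add_mod_right, Nat.add_div_right _ (hq i)]
    ring
  · refine Finset.prod_congr rfl fun j hj => ?_
    have : j ≠ i := Finset.ne_of_mem_erase hj
    simp [Finsupp.single_apply, this.symm]

lemma gfam_ideal (hq : ∀ i, 0 < q i) (hspan : Submodule.span k (Set.range (gfam q f)) = ⊤)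
    (A : Finset (Fin m)) :
    (Ideal.span (f '' A)).restrictScalars k =
      Submodule.span k (gfam q f '' {a | ∃ i ∈ A, q i ≤ a i}) := by
  apply le_antisymm
  · intro x hx
    replace hx : x ∈ Ideal.span (f '' A) := hx
    have key : ∀ r : MvPolynomial (Fin m) k,
        r * x ∈ Submodule.span k (gfam q f '' {a | ∃ i ∈ A, q i ≤ a i}) := by
      induction hx using Submodule.span_induction with
      | mem x hx =>
        obtain ⟨i, hi, rfl⟩ := hx
        intro r
        have hr : r ∈ Submodule.span k (Set.range (gfam q f)) := by rw [hspan]; trivial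
        induction hr using Submodule.span_induction with
        | mem r hr =>
          obtain ⟨a, rfl⟩ := hr
          rw [mul_comm, gfam_mul q f hq]
          exact Submodule.subset_span ⟨_, ⟨i, hi, by simp⟩, rfl⟩
        | zero => simp
        | add r r' _ _ h h' => rw [add_mul]; exact Submodule.add_mem _ h h'
        | smul c r _ h => rw [smul_mul_assoc]; exact Submodule.smul_mem _ _ h
      | zero => simp
      | add x y _ _ hx hy => intro r; rw [mul_add]; exact Submodule.add_mem _ (hx r) (hy r)
      | smul a x _ hx => intro r; rw [smul_eq_mul, ← mul_assoc]; exact hx _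
    simpa using key 1
  · rw [Submodule.span_le]
    rintro _ ⟨a, ⟨i, hi, hia⟩, rfl⟩
    have : a = (a - Finsupp.single i (q i)) + Finsupp.single i (q i) :=
      (tsub_add_cancel_of_le (by rw [Finsupp.single_le_iff]; exact hia)).symm
    rw [this, ← gfam_mul q f hq]
    exact Ideal.mul_mem_right _ _ (Ideal.subset_span ⟨i, hi, rfl⟩)

lemma gfam_hom (w : Fin m → ℕ) (hf : ∀ i, IsWeightedHomogeneous w (f i) (q i * w i)) (a : Fin m →₀ ℕ) :
    IsWeightedHomogeneous w (gfam q f a) (Finsupp.weight w a) := by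
  have : Finsupp.weight w a = ∑ i, ((a i % q i) • w i + (a i / q i) • (q i * w i)) := by
    rw [Finsupp.weight_apply, Finsupp.sum_fintype _ _ (by simp)]
    refine Finset.sum_congr rfl fun i _ => ?_
    simp only [smul_eq_mul]
    conv_lhs => rw [← Nat.mod_add_div (a i) (q i)]
    ring
  rw [this]
  refine IsWeightedHomogeneous.prod _ _ _ fun i _ => ?_
  exact ((isWeightedHomogeneous_X k w i).pow _).mul ((hf i).pow _)

lemma gfam_homspan (w : Fin m → ℕ) (hf : ∀ i, IsWeightedHomogeneous w (f i) (q i * w i))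
    (hspan : Submodule.span k (Set.range (gfam q f)) = ⊤) (n : ℕ) :
    weightedHomogeneousSubmodule k w n = Submodule.span k (gfam q f '' {a | Finsupp.weight w a = n}) := by
  apply le_antisymm
  · intro x hx
    rw [mem_weightedHomogeneousSubmodule] at hx
    rw [← hx.weightedHomogeneousComponent_same]
    have hx' : x ∈ Submodule.span k (Set.range (gfam q f)) := by rw [hspan]; trivial
    clear hx
    induction hx' using Submodule.span_induction with
    | mem x hx =>
      obtain ⟨a, rfl⟩ := hx
      by_cases h : Finsupp.weight w a = n
      · have := gfam_hom q f w hf a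
        rw [h] at this
        rw [this.weightedHomogeneousComponent_same]
        exact Submodule.subset_span ⟨a, h, rfl⟩
      · rw [(gfam_hom q f w hf a).weightedHomogeneousComponent_ne n (Ne.symm h)]
        exact Submodule.zero_mem _
    | zero => simp
    | add x y _ _ hx hy => rw [map_add]; exact Submodule.add_mem _ hx hy
    | smul c x _ hx => rw [map_smul]; exact Submodule.smul_mem _ _ hx
  · rw [Submodule.span_le]
    rintro _ ⟨a, ha, rfl⟩
    have := gfam_hom q f w hf a
    rw [ha] at this
    exact this
end gf

section tw
variable {p : ℕ} {k : Type*} [Field k] {m : ℕ} {d : Fin m → ℕ}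

noncomputable def WW (p : ℕ) (k : Type*) [Field k] {m : ℕ} (d : Fin m → ℕ) (l n : ℕ) :
    Submodule k (MvPolynomial (Fin m) k) :=
  Submodule.span k {f | ∃ i : Fin m, n ≤ i.val ∧ d i ≤ l ∧ f = X i ^ p ^ (l - d i)}

lemma WW_zero (l : ℕ) : WW p k d l 0 = FPV p k m d l := by
  simp [WW, FPV]

lemma WW_mono (l : ℕ) {n n' : ℕ} (h : n ≤ n') : WW p k d l n' ≤ WW p k d l n := by
  apply Submodule.span_mono
  rintro _ ⟨i, h1, h2, rfl⟩
  exact ⟨i, h.trans h1, h2, rfl⟩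

lemma WW_X (l : ℕ) (i : Fin m) (h : d i ≤ l) : (X i ^ p ^ (l - d i) : MvPolynomial (Fin m) k) ∈ WW p k d l i :=
  Submodule.subset_span ⟨i, le_rfl, h, rfl⟩

lemma WW_pow (hp : p.Prime) [CharP k p] (l n s : ℕ) (v : MvPolynomial (Fin m) k) (hv : v ∈ WW p k d l n) :
    v ^ p ^ s ∈ WW p k d (l + s) n := by
  have : ExpChar (MvPolynomial (Fin m) k) p := by
    have := Fact.mk hp
    exact ExpChar.prime hp
  induction hv using Submodule.span_induction with
  | mem v hv =>
    obtain ⟨i, h1, h2, rfl⟩ := hv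
    refine Submodule.subset_span ⟨i, h1, by omega, ?_⟩
    rw [← pow_mul, ← pow_add]
    congr 2
    omega
  | zero => rw [zero_pow (pow_ne_zero _ hp.ne_zero)]; exact Submodule.zero_mem _
  | add x y _ _ hx hy => rw [add_pow_expChar_pow]; exact Submodule.add_mem _ hx hy
  | smul c x _ hx => rw [smul_pow]; exact Submodule.smul_mem _ _ hx

lemma WW_succ (l : ℕ) (n : Fin m) (v : MvPolynomial (Fin m) k) (hv : v ∈ WW p k d l n) :
    ∃ c : k, ∃ w ∈ WW p k d l (n + 1), v = w + c • X n ^ p ^ (l - d n) ∧ (c ≠ 0 → d n ≤ l) := by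
  induction hv using Submodule.span_induction with
  | mem v hv =>
    obtain ⟨i, h1, h2, rfl⟩ := hv
    rcases eq_or_ne i n with rfl | hne
    · exact ⟨1, 0, Submodule.zero_mem _, by simp, fun _ => h2⟩
    · refine ⟨0, _, Submodule.subset_span ⟨i, ?_, h2, rfl⟩, by simp, by simp⟩
      have : (i : ℕ) ≠ n := fun h => hne (Fin.ext h)
      omega
  | zero => exact ⟨0, 0, Submodule.zero_mem _, by simp, by simp⟩
  | add x y _ _ hx hy =>
    obtain ⟨c, w, hw, rfl, hc⟩ := hx
    obtain ⟨c', w', hw', rfl, hc'⟩ := hy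
    refine ⟨c + c', w + w', Submodule.add_mem _ hw hw', by rw [add_smul]; abel, fun h => ?_⟩
    by_cases h0 : c = 0
    · apply hc'; rintro rfl; simp [h0] at h
    · exact hc h0
  | smul a x _ hx =>
    obtain ⟨c, w, hw, rfl, hc⟩ := hx
    refine ⟨a * c, a • w, Submodule.smul_mem _ _ hw, by rw [smul_add, mul_smul], fun h => hc ?_⟩
    rintro rfl; simp at h

lemma WW_top (l n : ℕ) (hn : m ≤ n) (v : MvPolynomial (Fin m) k) (hv : v ∈ WW p k d l n) : v = 0 := by
  induction hv using Submodule.span_induction with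
  | mem v hv =>
    obtain ⟨i, h1, h2, rfl⟩ := hv
    have := i.2
    omega
  | zero => rfl
  | add x y _ _ hx hy => rw [hx, hy, add_zero]
  | smul a x _ hx => rw [hx, smul_zero]

lemma WW_coeff (l n : ℕ) (v : MvPolynomial (Fin m) k) (hv : v ∈ WW p k d l n) :
    ∀ c, coeff c v ≠ 0 → ∃ j : Fin m, n ≤ j ∧ ∃ N, c = Finsupp.single j N := by
  induction hv using Submodule.span_induction with
  | mem v hv =>
    obtain ⟨i, h1, h2, rfl⟩ := hv
    intro c hc
    rw [coeff_X_pow] at hc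
    refine ⟨i, h1, p ^ (l - d i), ?_⟩
    by_contra h
    exact hc (if_neg (fun h' => h h'.symm))
  | zero => simp
  | add x y _ _ hx hy =>
    intro c hc
    by_cases h : coeff c x = 0
    · apply hy; rintro h'; simp [h, h'] at hc
    · exact hx c h
  | smul a x _ hx =>
    intro c hc
    apply hx
    rintro h; simp [h] at hc

lemma WW_hom (l n : ℕ) (v : MvPolynomial (Fin m) k) (hv : v ∈ WW p k d l n) :
    IsWeightedHomogeneous (fun i => p ^ d i) v (p ^ l) := by
  have : WW p k d l n ≤ weightedHomogeneousSubmodule k (fun i => p ^ d i) (p ^ l) := by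
    refine Submodule.span_le.2 ?_
    rintro _ ⟨i, h1, h2, rfl⟩
    have := (isWeightedHomogeneous_X k (fun i => p ^ d i) i).pow (p ^ (l - d i))
    rw [smul_eq_mul, ← pow_add, Nat.sub_add_cancel h2] at this
    exact this
  exact this hv

lemma WW_lt (l : ℕ) (i : Fin m) (N : ℕ) (hN : 0 < N) (v : MvPolynomial (Fin m) k) (hv : v ∈ WW p k d l (i + 1)) :
    MonomialOrder.lex.toSyn (MonomialOrder.lex.degree v) < MonomialOrder.lex.toSyn (Finsupp.single i N) := by
  rw [MonomialOrder.degree_lt_iff]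
  · intro c hc
    obtain ⟨j, hj, n, rfl⟩ := WW_coeff l _ v hv c (mem_support_iff.1 hc)
    rw [MonomialOrder.lex_lt_iff]
    have hij : i < j := by rw [Fin.lt_def]; omega
    refine ⟨i, fun r hr => ?_, ?_⟩
    · have h1 : i ≠ r := hr.ne'
      have h2 : j ≠ r := (hr.trans hij).ne'
      simp [Finsupp.single_apply, h1, h2]
    · have h2 : j ≠ i := hij.ne'
      simp [Finsupp.single_apply, h2, hN]
  · rw [map_zero, MonomialOrder.toSyn_lt_iff_ne_zero, Ne, EmbeddingLike.map_eq_zero_iff]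
    simp [hN.ne']

lemma lead (l : ℕ) (i : Fin m) (N : ℕ) (hN : 0 < N) (f : MvPolynomial (Fin m) k)
    (hf : f - X i ^ N ∈ WW p k d l (i + 1)) :
    MonomialOrder.lex.Monic f ∧ MonomialOrder.lex.degree f = Finsupp.single i N := by
  have h1 : MonomialOrder.lex.degree (X i ^ N : MvPolynomial (Fin m) k) = Finsupp.single i N := by
    rw [MonomialOrder.degree_pow, MonomialOrder.degree_X]; simp
  have h2 := WW_lt l i N hN _ hf
  rw [← h1] at h2
  have h3 : f = X i ^ N + (f - X i ^ N) := by ring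
  constructor
  · rw [h3]; exact MonomialOrder.Monic.add_of_lt (MonomialOrder.monic_X.pow) h2
  · rw [h3, MonomialOrder.degree_add_of_lt h2, h1]

structure TwData (p : ℕ) (k : Type*) [Field k] {m : ℕ} (d : Fin m → ℕ) (M : ℕ)
    (I : Ideal (MvPolynomial (Fin m) k)) (A : Finset (Fin m)) (e : Fin m → ℕ)
    (f : Fin m → MvPolynomial (Fin m) k) : Prop where
  hde : ∀ i, d i ≤ e i
  hf : ∀ i, f i - X i ^ p ^ (e i - d i) ∈ WW p k d (e i) (i + 1)
  hM : ∀ i ∈ A, e i ≤ M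
  hI : I = Ideal.span (f '' A)
  hV : ∀ l ≤ M, FPV p k m d l ⊓ I.restrictScalars k =
    Submodule.span k ((fun i => f i ^ p ^ (l - e i)) '' {i | i ∈ A ∧ e i ≤ l})

lemma exists_TwData (hp : p.Prime) [CharP k p] (M : ℕ) (I : Ideal (MvPolynomial (Fin m) k))
    (htl : ∃ s : Finset (MvPolynomial (Fin m) k),
      (∀ f ∈ s, ∃ l : ℕ, l ≤ M ∧ f ∈ FPV p k m d l) ∧ I = Ideal.span s) :
    ∃ A e f, TwData p k d M I A e f := by
  classical
  have hE : ExpChar (MvPolynomial (Fin m) k) p := ExpChar.prime hp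
  let P : Fin m → ℕ → Prop := fun i l => d i ≤ l ∧ l ≤ M ∧
    ∃ v ∈ I, v - X i ^ p ^ (l - d i) ∈ WW p k d l (i + 1)
  have hex : ∀ i, ∃ (e : ℕ) (f : MvPolynomial (Fin m) k), d i ≤ e ∧
      f - X i ^ p ^ (e - d i) ∈ WW p k d e (i + 1) ∧
      ((∃ l, P i l) → e ≤ M ∧ f ∈ I ∧ ∀ l, P i l → e ≤ l) := by
    intro i
    by_cases h : ∃ l, P i l
    · obtain ⟨h1, h2, v, hv, h3⟩ := Nat.find_spec h
      exact ⟨Nat.find h, v, h1, h3, fun _ => ⟨h2, hv, fun l hl => Nat.find_min' h hl⟩⟩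
    · exact ⟨d i, X i, le_rfl, by simp, fun h' => absurd h' h⟩
  choose e f hde hf hP using hex
  let A : Finset (Fin m) := Finset.univ.filter (fun i => ∃ l, P i l)
  have hA : ∀ i, i ∈ A ↔ ∃ l, P i l := by intro i; simp [A]
  have hfp : ∀ i l, e i ≤ l → f i ^ p ^ (l - e i) - X i ^ p ^ (l - d i) ∈ WW p k d l (i + 1) := by
    intro i l hl
    have h := WW_pow hp _ _ (l - e i) _ (hf i)
    rw [sub_pow_expChar_pow, ← pow_mul, ← pow_add] at h
    have h1 : e i - d i + (l - e i) = l - d i := by have := hde i; omega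
    have h2 : e i + (l - e i) = l := by omega
    rwa [h1, h2] at h
  have hfI : ∀ i ∈ A, f i ∈ I := fun i hi => (hP i ((hA i).1 hi)).2.1
  have key : ∀ l ≤ M, ∀ t n : ℕ, m ≤ n + t → ∀ v ∈ WW p k d l n, v ∈ I →
      v ∈ Submodule.span k ((fun i => f i ^ p ^ (l - e i)) '' {i | i ∈ A ∧ e i ≤ l}) := by
    intro l hl t
    induction t with
    | zero =>
      intro n hn v hv _
      rw [WW_top l n (by omega) v hv]; exact Submodule.zero_mem _
    | succ t ih =>
      intro n hn v hv hvI
      by_cases hnm : m ≤ n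
      · rw [WW_top l n hnm v hv]; exact Submodule.zero_mem _
      obtain ⟨c, w, hw, hvw, hc⟩ := WW_succ l ⟨n, by omega⟩ v hv
      simp only at hw hvw hc
      by_cases hc0 : c = 0
      · rw [hc0, zero_smul, add_zero] at hvw
        exact ih (n + 1) (by omega) v (hvw ▸ hw) hvI
      · set i : Fin m := ⟨n, by omega⟩ with hi
        have hPi : P i l := by
          refine ⟨hc hc0, hl, c⁻¹ • v, Submodule.smul_of_tower_mem _ _ hvI, ?_⟩
          have : c⁻¹ • v - X i ^ p ^ (l - d i) = c⁻¹ • w := by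
            rw [hvw, smul_add, smul_smul, inv_mul_cancel₀ hc0, one_smul, add_sub_cancel_right]
          rw [this]
          exact Submodule.smul_mem _ _ hw
        have hiA : i ∈ A := (hA i).2 ⟨l, hPi⟩
        have hel : e i ≤ l := (hP i ⟨l, hPi⟩).2.2 l hPi
        have hmem : c • f i ^ p ^ (l - e i) ∈ Submodule.span k ((fun i => f i ^ p ^ (l - e i)) '' {i | i ∈ A ∧ e i ≤ l}) :=
          Submodule.smul_mem _ _ (Submodule.subset_span ⟨i, ⟨hiA, hel⟩, rfl⟩)
        rw [← sub_add_cancel v (c • f i ^ p ^ (l - e i))]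
        refine Submodule.add_mem _ (ih (n + 1) (by omega) _ ?_ ?_) hmem
        · have : v - c • f i ^ p ^ (l - e i) = w - c • (f i ^ p ^ (l - e i) - X i ^ p ^ (l - d i)) := by
            rw [hvw, smul_sub]; abel
          rw [this]
          exact Submodule.sub_mem _ hw (Submodule.smul_mem _ _ (hfp i l hel))
        · exact Submodule.sub_mem _ hvI (Submodule.smul_of_tower_mem _ _
            (Ideal.pow_mem_of_mem _ (hfI i hiA) _ (pow_pos hp.pos _)))
  refine ⟨A, e, f, hde, hf, fun i hi => (hP i ((hA i).1 hi)).1, ?_, ?_⟩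
  · apply le_antisymm
    · obtain ⟨s, hs, hIs⟩ := htl
      conv_lhs => rw [hIs]
      rw [Ideal.span_le]
      intro g hg
      obtain ⟨l, hl, hgl⟩ := hs g hg
      rw [← WW_zero] at hgl
      have h := key l hl m 0 (by omega) g hgl (hIs ▸ Ideal.subset_span hg)
      have hle : Submodule.span k ((fun i => f i ^ p ^ (l - e i)) '' {i | i ∈ A ∧ e i ≤ l}) ≤
          (Ideal.span (f '' A)).restrictScalars k := by
        rw [Submodule.span_le]
        rintro _ ⟨i, ⟨hi, _⟩, rfl⟩
        have hfi : f i ∈ Ideal.span (f '' (A : Set (Fin m))) := Ideal.subset_span ⟨i, hi, rfl⟩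
        exact Ideal.pow_mem_of_mem _ hfi _ (pow_pos hp.pos _)
      exact hle h
    · rw [Ideal.span_le]
      rintro _ ⟨i, hi, rfl⟩
      exact hfI i hi
  · intro l hl
    apply le_antisymm
    · rintro v ⟨hv, hvI⟩
      rw [SetLike.mem_coe, ← WW_zero] at hv
      exact key l hl m 0 (by omega) v hv hvI
    · rw [Submodule.span_le]
      rintro _ ⟨i, ⟨hi, hel⟩, rfl⟩
      refine ⟨?_, Ideal.pow_mem_of_mem _ (hfI i hi) _ (pow_pos hp.pos _)⟩
      rw [SetLike.mem_coe, ← WW_zero]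
      have h1 := WW_mono l (Nat.zero_le _) (hfp i l hel)
      have h2 := WW_mono l (Nat.zero_le _) (WW_X (p := p) (k := k) l i ((hde i).trans hel))
      simpa using Submodule.add_mem _ h1 h2

lemma TwData.main (hp : p.Prime) {M : ℕ} {I : Ideal (MvPolynomial (Fin m) k)}
    {A e f} (h : TwData p k d M I A e f) :
    (∀ n, hilbertFn p k m d I n = cnt (fun i => p ^ d i) (fun i => p ^ (e i - d i)) A n) ∧
    ∀ l ≤ M, Module.finrank k ↥(FPV p k m d l ⊓ I.restrictScalars k) =
      (A.filter (fun i => e i ≤ l)).card := by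
  have hq : ∀ i, 0 < p ^ (e i - d i) := fun i => pow_pos hp.pos _
  set q : Fin m → ℕ := fun i => p ^ (e i - d i) with hqd
  have hm : ∀ i, MonomialOrder.lex.Monic (f i) := fun i => (lead _ i _ (hq i) _ (h.hf i)).1
  have hd : ∀ i, MonomialOrder.lex.degree (f i) = Finsupp.single i (q i) :=
    fun i => (lead _ i _ (hq i) _ (h.hf i)).2
  have hli := g_li MonomialOrder.lex (gfam q f) (gfam_monic _ q f hm) (gfam_degree _ q f hm hd)
  have hsp := g_span MonomialOrder.lex (gfam q f) (gfam_monic _ q f hm) (gfam_degree _ q f hm hd)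
  have hfh : ∀ i, IsWeightedHomogeneous (fun i => p ^ d i) (f i) (q i * p ^ d i) := by
    intro i
    have h1 := WW_mono _ (Nat.zero_le _) (h.hf i)
    have h2 := WW_mono _ (Nat.zero_le _) (WW_X (p := p) (k := k) _ i (h.hde i))
    have h3 := WW_hom _ _ _ (Submodule.add_mem _ h1 h2)
    rw [hqd]
    simp only
    rw [← pow_add, Nat.sub_add_cancel (h.hde i)]
    simpa using h3
  constructor
  · intro n
    unfold hilbertFn
    rw [quot_finrank (gfam q f) hli _ _ (wt_finite (fun i => p ^ d i) (fun i => pow_ne_zero _ hp.ne_zero) n) _ _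
      (gfam_homspan q f _ hfh hsp n) (by rw [h.hI]; exact gfam_ideal q f hq hsp A)]
    unfold cnt
    congr 1
    ext a
    simp [hqd]
  · intro l hl
    rw [h.hV l hl]
    have e1 : (fun i => f i ^ p ^ (l - e i)) '' {i | i ∈ A ∧ e i ≤ l} =
        gfam q f '' ((fun i : Fin m => Finsupp.single i (p ^ (l - d i))) '' {i | i ∈ A ∧ e i ≤ l}) := by
      rw [Set.image_image]
      refine Set.image_congr fun i hi => ?_
      have hel : e i ≤ l := hi.2
      have hpp : p ^ (l - d i) = p ^ (l - e i) * q i := by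
        rw [hqd]; simp only; rw [← pow_add]; congr 1; have := h.hde i; omega
      unfold gfam
      rw [Finset.prod_eq_single i]
      · rw [Finsupp.single_eq_same, hpp, Nat.mul_mod_left, Nat.mul_div_cancel _ (hq i), pow_zero, one_mul]
      · intro j _ hji
        simp [Finsupp.single_apply, hji.symm]
      · simp
    rw [e1, li_finrank _ hli _ ((Set.toFinite _).image _), Set.ncard_image_of_injective]
    · rw [← Set.ncard_coe_finset]
      congr 1
      ext i
      simp
    · intro i j hij
      exact (Finsupp.single_eq_single_iff _ _ _ _).1 hij |>.elim (fun h => h.1) (fun h => absurd h.1 (pow_ne_zero _ hp.ne_zero))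
end tw

/-- Let `I`, `I'` be twisted-linear ideals of `k[𝔛]`, each generated by twisted-linear
elements of degree `≤ p^M`. Then their Hilbert functions coincide if and only if
`dim_k (FPV_i(k) ∩ I) = dim_k (FPV_i(k) ∩ I')` for all `i = 0, 1, …, M`. -/
theorem hilbertFn_eq_iff_FPV_inter_dims_eq
    (p : ℕ) (hp : p.Prime) (k : Type*) [Field k] [CharP k p]
    (mv : ℕ) (d : Fin mv → ℕ) (M : ℕ)
    (I I' : Ideal (MvPolynomial (Fin mv) k))
    (htl : ∃ s : Finset (MvPolynomial (Fin mv) k),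
      (∀ f ∈ s, ∃ l : ℕ, l ≤ M ∧ f ∈ FPV p k mv d l) ∧ I = Ideal.span s)
    (htl' : ∃ s : Finset (MvPolynomial (Fin mv) k),
      (∀ f ∈ s, ∃ l : ℕ, l ≤ M ∧ f ∈ FPV p k mv d l) ∧ I' = Ideal.span s) :
    (∀ dd : ℕ, hilbertFn p k mv d I dd = hilbertFn p k mv d I' dd) ↔
      ∀ i : ℕ, i ≤ M →
        Module.finrank k ↥(FPV p k mv d i ⊓ I.restrictScalars k)
          = Module.finrank k ↥(FPV p k mv d i ⊓ I'.restrictScalars k) := by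
  obtain ⟨A, e, f, h⟩ := exists_TwData hp M I htl
  obtain ⟨A', e', f', h'⟩ := exists_TwData hp M I' htl'
  obtain ⟨h1, h2⟩ := h.main hp
  obtain ⟨h1', h2'⟩ := h'.main hp
  have hc := comb_main p hp M d e e' A A' h.hde h'.hde h.hM h'.hM
  simp only [h1, h1']
  rw [hc]
  refine forall₂_congr fun l hl => ?_
  rw [h2 l hl, h2' l hl]
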